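/- arXiv:1206.0715 — 4 statements merged into one kernel-verified Lean document; each statement's English description precedes it below -/
import Mathlib

section
/- Let U be a utility function and V its convex conjugate. Then V is strictly convex, strictly decreasing and continuous on (0,∞). -/
open Set Filter

lemma aux_max (U U' V : ℝ → ℝ)
    (hU_conc : StrictConcaveOn ℝ (Ioi 0) U)
    (hU_deriv : ∀ x ∈ Ioi (0 : ℝ), HasDerivAt U (U' x) x)
    (hU'_cont : ContinuousOn U' (Ioi 0))
    (hInada_zero : Tendsto U' (nhdsWithin 0 (Ioi 0)) atTop)
    (hInada_top : Tendsto U' atTop (nhds 0))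
    (hV : ∀ y ∈ Ioi (0 : ℝ), IsLUB ((fun x => U x - x * y) '' Ioi 0) (V y))
    (y : ℝ) (hy : 0 < y) : ∃ x, 0 < x ∧ U' x = y ∧ V y = U x - x * y := by
  obtain ⟨a, ha, ha0⟩ := ((hInada_zero.eventually (eventually_ge_atTop y)).and
    self_mem_nhdsWithin).exists
  obtain ⟨b, hb, hb0⟩ := ((hInada_top.eventually (eventually_le_nhds hy)).and
    (eventually_gt_atTop 0)).exists
  obtain ⟨x, hx0, hx⟩ := isPreconnected_Ioi.intermediate_value (a := b) (b := a)
    (s := Ioi (0:ℝ)) hb0 ha0 hU'_cont ⟨hb, ha⟩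
  have hx0' : 0 < x := hx0
  refine ⟨x, hx0, hx, (hV y hy).unique (IsGreatest.isLUB ⟨⟨x, hx0, rfl⟩, ?_⟩)⟩
  rintro _ ⟨z, hz, rfl⟩
  have hd := hU_deriv x hx0
  rw [hx] at hd
  have hc := hU_conc.concaveOn
  simp only
  rcases lt_trichotomy z x with h | h | h
  · have := hc.le_slope_of_hasDerivAt hz hx0 h hd
    rw [slope_def_field, le_div_iff₀ (by linarith)] at this
    nlinarith
  · subst h; exact le_rfl
  · have := hc.slope_le_of_hasDerivAt hx0 hz h hd
    rw [slope_def_field, div_le_iff₀ (by linarith)] at this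
    nlinarith

/-- If `U` is a utility function and `V(y) = sup_{x>0} (U x - x*y)` is its
convex conjugate, then `V` is strictly convex, strictly decreasing and continuous
on `(0,∞)`. -/
theorem statement_1 (U U' V : ℝ → ℝ)
    (hU_mono : StrictMonoOn U (Ioi 0))
    (hU_conc : StrictConcaveOn ℝ (Ioi 0) U)
    (hU_deriv : ∀ x ∈ Ioi (0 : ℝ), HasDerivAt U (U' x) x)
    (hU'_cont : ContinuousOn U' (Ioi 0))
    (hInada_zero : Tendsto U' (nhdsWithin 0 (Ioi 0)) atTop)
    (hInada_top : Tendsto U' atTop (nhds 0))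
    (hV : ∀ y ∈ Ioi (0 : ℝ), IsLUB ((fun x => U x - x * y) '' Ioi 0) (V y)) :
    StrictConvexOn ℝ (Ioi 0) V ∧ StrictAntiOn V (Ioi 0) ∧ ContinuousOn V (Ioi 0) := by
  have key := aux_max U U' V hU_conc hU_deriv hU'_cont hInada_zero hInada_top hV
  have hle : ∀ x y : ℝ, 0 < x → 0 < y → U x - x * y ≤ V y := fun x y hx hy =>
    (hV y hy).1 ⟨x, hx, rfl⟩
  have hlt : ∀ x y : ℝ, 0 < x → 0 < y → U' x ≠ y → U x - x * y < V y := by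
    intro x y hx hy hne
    refine lt_of_le_of_ne (hle x y hx hy) fun he => hne ?_
    have hm : IsLocalMax (fun z => U z - z * y) x := by
      filter_upwards [Ioi_mem_nhds hx] with z hz
      have := hle z y hz hy
      linarith
    have hd : HasDerivAt (fun z => U z - z * y) (U' x - 1 * y) x :=
      (hU_deriv x hx).sub ((hasDerivAt_id x).mul_const y)
    have := hm.hasDerivAt_eq_zero hd
    linarith
  have hconv : StrictConvexOn ℝ (Ioi 0) V := by
    refine ⟨convex_Ioi 0, ?_⟩
    intro y₁ h₁ y₂ h₂ hne a b ha hb hab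
    have h₁' : 0 < y₁ := h₁
    have h₂' : 0 < y₂ := h₂
    simp only [smul_eq_mul]
    obtain ⟨x, hx, hxy, hVx⟩ := key (a * y₁ + b * y₂) (by positivity)
    have hb' : b = 1 - a := by linarith
    have e1 : U' x ≠ y₁ := by
      intro h
      have : b * (y₂ - y₁) = 0 := by rw [hb'] at hxy ⊢; linarith
      rcases mul_eq_zero.1 this with h | h
      · linarith
      · exact hne (by linarith)
    have t1 := mul_lt_mul_of_pos_left (hlt x y₁ hx h₁ e1) ha
    have t2 := mul_le_mul_of_nonneg_left (hle x y₂ hx h₂) hb.le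
    rw [hVx]
    have : U x - x * (a * y₁ + b * y₂) = a * (U x - x * y₁) + b * (U x - x * y₂) := by
      rw [hb']; ring
    linarith
  refine ⟨hconv, ?_, hconv.convexOn.continuousOn isOpen_Ioi⟩
  intro y₁ h₁ y₂ h₂ h
  obtain ⟨x, hx, hxy, hVx⟩ := key y₂ h₂
  have := hle x y₁ hx h₁
  have := mul_lt_mul_of_pos_left h hx
  linarith
end

section
/- Let U be a utility function and V its convex conjugate. Then V is continuously differentiable on (0,∞) and its derivative satisfies V'(y) = −I(y) for every y > 0, where I := (U')⁻¹ is the inverse function of U'. -/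
open Set Filter

/-- If `U` is a utility function with convex conjugate
`V(y) = sup_{x>0} (U x - x*y)`, and `I = (U')⁻¹` is the inverse function of `U'`,
then `V` is continuously differentiable on `(0,∞)` with `V' y = -(I y)` for all `y > 0`. -/
theorem statement_2 (U U' V I : ℝ → ℝ)
    (hU_mono : StrictMonoOn U (Ioi 0))
    (hU_conc : StrictConcaveOn ℝ (Ioi 0) U)
    (hU_deriv : ∀ x ∈ Ioi (0 : ℝ), HasDerivAt U (U' x) x)
    (hU'_cont : ContinuousOn U' (Ioi 0))
    (hInada_zero : Tendsto U' (nhdsWithin 0 (Ioi 0)) atTop)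
    (hInada_top : Tendsto U' atTop (nhds 0))
    (hV : ∀ y ∈ Ioi (0 : ℝ), IsLUB ((fun x => U x - x * y) '' Ioi 0) (V y))
    (hI_right : ∀ y ∈ Ioi (0 : ℝ), I y ∈ Ioi (0 : ℝ) ∧ U' (I y) = y)
    (hI_left : ∀ x ∈ Ioi (0 : ℝ), I (U' x) = x) :
    (∀ y ∈ Ioi (0 : ℝ), HasDerivAt V (-(I y)) y) ∧
      ContinuousOn (fun y => -(I y)) (Ioi 0) := by
  have tang : ∀ x ∈ Ioi (0:ℝ), ∀ z ∈ Ioi (0:ℝ), U x ≤ U z + U' z * (x - z) := by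
    intro x hx z hz
    rcases lt_trichotomy x z with h | h | h
    · have := hU_conc.concaveOn.le_slope_of_hasDerivAt hx hz h (hU_deriv z hz)
      rw [slope_def_field, le_div_iff₀ (by linarith)] at this
      nlinarith
    · subst h; simp
    · have := hU_conc.concaveOn.slope_le_of_hasDerivAt hz hx h (hU_deriv z hz)
      rw [slope_def_field, div_le_iff₀ (by linarith)] at this
      linarith
  have hpos : ∀ x ∈ Ioi (0:ℝ), 0 < U' x := by
    intro x hx
    have hx1 : x + 1 ∈ Ioi (0:ℝ) := by
      simp only [mem_Ioi] at *
      linarith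
    have h1 := tang (x+1) hx1 x hx
    have h2 := hU_mono hx hx1 (by linarith)
    nlinarith
  have hVeq : ∀ y ∈ Ioi (0:ℝ), V y = U (I y) - I y * y := by
    intro y hy
    obtain ⟨hi, he⟩ := hI_right y hy
    refine (hV y hy).unique (IsGreatest.isLUB ⟨⟨I y, hi, rfl⟩, ?_⟩)
    rintro _ ⟨x, hx, rfl⟩
    have := tang x hx (I y) hi
    rw [he] at this
    simp only
    nlinarith
  have sub : ∀ y ∈ Ioi (0:ℝ), ∀ w ∈ Ioi (0:ℝ), V y - I y * (w - y) ≤ V w := by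
    intro y hy w hw
    have h := (hV w hw).1 ⟨I y, (hI_right y hy).1, rfl⟩
    have h2 := hVeq y hy
    simp only at h
    nlinarith
  have hmono : MonotoneOn (fun y => -(I y)) (Ioi 0) := by
    intro y hy w hw hyw
    rcases hyw.eq_or_lt with h | h
    · rw [h]
    · have h1 := sub y hy w hw
      have h2 := sub w hw y hy
      simp only
      by_contra hc
      push Not at hc
      nlinarith [mul_pos (sub_pos.2 h) (sub_pos.2 hc)]
  have hcontAt : ∀ y ∈ Ioi (0:ℝ), ContinuousAt (fun y => -(I y)) y := by
    intro y hy
    refine continuousAt_of_monotoneOn_of_image_mem_nhds hmono (Ioi_mem_nhds hy) ?_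
    have hI := (hI_right y hy).1
    refine mem_of_superset (Iio_mem_nhds (neg_lt_zero.2 hI)) ?_
    intro t ht
    have ht' : -t ∈ Ioi (0:ℝ) := by simpa using ht
    exact ⟨U' (-t), hpos _ ht', by simp [hI_left _ ht']⟩
  refine ⟨?_, fun y hy => (hcontAt y hy).continuousWithinAt⟩
  intro y hy
  rw [hasDerivAt_iff_isLittleO, Asymptotics.isLittleO_iff]
  intro c hc
  filter_upwards [Ioi_mem_nhds hy, Metric.continuousAt_iff'.1 (hcontAt y hy) c hc] with w hw hd
  have h1 := sub y hy w hw
  have h2 := sub w hw y hy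
  rw [Real.dist_eq] at hd
  simp only [Real.norm_eq_abs, smul_eq_mul]
  have h3 : |V w - V y - (w - y) * -(I y)| ≤ |(-(I w) - -(I y)) * (w - y)| := by
    rw [abs_of_nonneg (by nlinarith)]
    refine le_trans ?_ (le_abs_self _)
    nlinarith
  rw [abs_mul] at h3
  exact h3.trans (mul_le_mul_of_nonneg_right hd.le (abs_nonneg _))
end

section
/- Let U be a utility function and V its convex conjugate. Then the derivative of V satisfies the limit conditions lim_{y→0+} V'(y) = −∞ and lim_{y→∞} V'(y) = 0. -/
open Set Filter

/-- If `U` is a utility function with convex conjugate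
`V(y) = sup_{x>0} (U x - x*y)`, which is differentiable on `(0,∞)` with derivative `V'`,
then `V'(y) → -∞` as `y → 0+` and `V'(y) → 0` as `y → ∞`. -/
theorem statement_3 (U U' V V' : ℝ → ℝ)
    (hU_mono : StrictMonoOn U (Ioi 0))
    (hU_conc : StrictConcaveOn ℝ (Ioi 0) U)
    (hU_deriv : ∀ x ∈ Ioi (0 : ℝ), HasDerivAt U (U' x) x)
    (hU'_cont : ContinuousOn U' (Ioi 0))
    (hInada_zero : Tendsto U' (nhdsWithin 0 (Ioi 0)) atTop)
    (hInada_top : Tendsto U' atTop (nhds 0))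
    (hV : ∀ y ∈ Ioi (0 : ℝ), IsLUB ((fun x => U x - x * y) '' Ioi 0) (V y))
    (hV_deriv : ∀ y ∈ Ioi (0 : ℝ), HasDerivAt V (V' y) y) :
    Tendsto V' (nhdsWithin 0 (Ioi 0)) atBot ∧ Tendsto V' atTop (nhds 0) := by
  have htan : ∀ a > 0, ∀ b > 0, U b ≤ U a + U' a * (b - a) := by
    intro a ha b hb
    rcases lt_trichotomy a b with h | h | h
    · have := hU_conc.concaveOn.slope_le_of_hasDerivAt (mem_Ioi.2 ha) (mem_Ioi.2 hb) h (hU_deriv a ha)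
      rw [slope_def_field, div_le_iff₀ (by linarith)] at this
      linarith
    · subst h; simp
    · have := hU_conc.concaveOn.le_slope_of_hasDerivAt (mem_Ioi.2 hb) (mem_Ioi.2 ha) h (hU_deriv a ha)
      rw [slope_def_field, le_div_iff₀ (by linarith)] at this
      linarith
  have hanti : ∀ a > 0, ∀ b > 0, a ≤ b → U' b ≤ U' a := by
    intro a ha b hb hab
    rcases hab.eq_or_lt with h | h
    · rw [h]
    · have h1 := htan a ha b hb
      have h2 := htan b hb a ha
      by_contra hc
      push Not at hc
      nlinarith [mul_pos (sub_pos.2 hc) (sub_pos.2 h)]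
  have hpos : ∀ a > 0, 0 < U' a := by
    intro a ha
    have h1 := htan a ha (a + 1) (by linarith)
    have h2 := hU_mono (mem_Ioi.2 ha) (mem_Ioi.2 (by linarith : (0 : ℝ) < a + 1)) (by linarith)
    simp at h1
    linarith
  have key : ∀ y > 0, ∃ x > 0, U' x = y ∧ V' y = -x := by
    intro y hy
    obtain ⟨x, hx, hxy⟩ : ∃ x > 0, U' x = y := by
      obtain ⟨a, ha1, ha⟩ := ((hInada_zero.eventually_ge_atTop y).and self_mem_nhdsWithin).exists
      obtain ⟨b, hb1, hb⟩ := ((hInada_top.eventually_le_const hy).and (eventually_gt_atTop 0)).exists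
      obtain ⟨x, hx, h⟩ := isPreconnected_Ioi.intermediate_value (mem_Ioi.2 hb) ha hU'_cont ⟨hb1, ha1⟩
      exact ⟨x, hx, h⟩
    refine ⟨x, hx, hxy, ?_⟩
    have hVle : V y ≤ U x - x * y := by
      apply (hV y hy).2
      rintro _ ⟨b, hb, rfl⟩
      have := htan x hx b hb
      rw [hxy] at this
      simp only
      linarith
    have hmin : IsLocalMin (fun z => V z + z * x) y := by
      filter_upwards [Ioi_mem_nhds hy] with z hz
      have : U x - x * z ≤ V z := (hV z hz).1 ⟨x, hx, rfl⟩
      linarith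
    have hd := (hV_deriv y hy).add ((hasDerivAt_id y).mul_const x)
    have := hmin.hasDerivAt_eq_zero hd
    linarith
  constructor
  · rw [tendsto_atBot]
    intro M
    have hN : (0 : ℝ) < max 1 (-M) := lt_max_of_lt_left one_pos
    filter_upwards [Ioo_mem_nhdsGT (hpos _ hN)] with y hy
    obtain ⟨x, hx, h1, h2⟩ := key y hy.1
    by_contra hc
    have : x ≤ max 1 (-M) := le_max_of_le_right (by linarith)
    have := hanti x hx _ hN this
    linarith [hy.2]
  · rw [Metric.tendsto_nhds]
    intro ε hε
    filter_upwards [eventually_gt_atTop (U' ε), eventually_gt_atTop 0] with y hy hy0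
    obtain ⟨x, hx, h1, h2⟩ := key y hy0
    rw [Real.dist_eq, h2, sub_zero, abs_neg, abs_of_pos hx]
    by_contra hc
    have := hanti ε hε x hx (by linarith)
    linarith
end

section
/- Let U be a utility function and V its convex conjugate. Then the boundary values of V match those of U: lim_{y→0+} V(y) = lim_{x→∞} U(x) (as elements of ℝ ∪ {+∞}) and lim_{y→∞} V(y) = lim_{x→0+} U(x) (as elements of ℝ ∪ {−∞}). -/
open Set Filter

/-- If `U` is a utility function with convex conjugate
`V(y) = sup_{x>0} (U x - x*y)`, then the boundary values of `V` match those of `U`: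
`lim_{y→0+} V(y) = lim_{x→∞} U(x)` as elements of `ℝ ∪ {+∞}` (i.e. in `EReal`,
with common value `≠ ⊥`), and `lim_{y→∞} V(y) = lim_{x→0+} U(x)` as elements of
`ℝ ∪ {-∞}` (common value `≠ ⊤` in `EReal`). -/
theorem statement_4 (U U' V : ℝ → ℝ)
    (hU_mono : StrictMonoOn U (Ioi 0))
    (hU_conc : StrictConcaveOn ℝ (Ioi 0) U)
    (hU_deriv : ∀ x ∈ Ioi (0 : ℝ), HasDerivAt U (U' x) x)
    (hU'_cont : ContinuousOn U' (Ioi 0))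
    (hInada_zero : Tendsto U' (nhdsWithin 0 (Ioi 0)) atTop)
    (hInada_top : Tendsto U' atTop (nhds 0))
    (hV : ∀ y ∈ Ioi (0 : ℝ), IsLUB ((fun x => U x - x * y) '' Ioi 0) (V y)) :
    (∃ L : EReal, L ≠ ⊥ ∧
        Tendsto (fun x => (U x : EReal)) atTop (nhds L) ∧
        Tendsto (fun y => (V y : EReal)) (nhdsWithin 0 (Ioi 0)) (nhds L)) ∧
    (∃ L : EReal, L ≠ ⊤ ∧
        Tendsto (fun x => (U x : EReal)) (nhdsWithin 0 (Ioi 0)) (nhds L) ∧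
        Tendsto (fun y => (V y : EReal)) atTop (nhds L)) := by
  constructor
  · refine ⟨sSup ((fun x => (U x : EReal)) '' Ioi 0), ?_, ?_, ?_⟩
    · have h : (U 1 : EReal) ≤ sSup ((fun x => (U x : EReal)) '' Ioi 0) :=
        le_sSup ⟨1, by simp, rfl⟩
      exact ne_of_gt (lt_of_lt_of_le (EReal.bot_lt_coe _) h)
    · rw [tendsto_order]
      constructor
      · intro a ha
        obtain ⟨_, ⟨x0, hx0, rfl⟩, h⟩ := lt_sSup_iff.1 ha
        filter_upwards [eventually_ge_atTop x0] with x hx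
        refine lt_of_lt_of_le h ?_
        exact EReal.coe_le_coe_iff.2
          (hU_mono.monotoneOn hx0 (lt_of_lt_of_le hx0 hx : (0:ℝ) < x) hx)
      · intro a ha
        filter_upwards [eventually_gt_atTop 0] with x hx
        exact lt_of_le_of_lt (le_sSup (mem_image_of_mem (fun x => (U x : EReal)) hx)) ha
    · rw [tendsto_order]
      constructor
      · intro a ha
        obtain ⟨_, ⟨x0, hx0, rfl⟩, h⟩ := lt_sSup_iff.1 ha
        obtain ⟨r, har, hr⟩ := EReal.lt_iff_exists_real_btwn.1 h
        have hr : r < U x0 := EReal.coe_lt_coe_iff.1 hr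
        have hx0' : 0 < x0 := hx0
        have hpos : 0 < (U x0 - r) / x0 := div_pos (by linarith) hx0'
        filter_upwards [Ioo_mem_nhdsGT hpos] with y hy
        have h1 : U x0 - x0 * y ≤ V y := (hV y hy.1).1 ⟨x0, hx0, rfl⟩
        have h2 := (lt_div_iff₀ hx0').1 hy.2
        exact har.trans (EReal.coe_lt_coe_iff.2 (by linarith))
      · intro a ha
        filter_upwards [self_mem_nhdsWithin] with y hy
        refine lt_of_le_of_lt ?_ ha
        by_contra hc
        obtain ⟨r, h1, h2⟩ := EReal.lt_iff_exists_real_btwn.1 (not_le.1 hc)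
        have h2 : r < V y := EReal.coe_lt_coe_iff.1 h2
        refine absurd ((hV y hy).2 ?_) (not_le.2 h2)
        rintro _ ⟨x, hx, rfl⟩
        have h3 : (U x : EReal) < r := lt_of_le_of_lt (le_sSup (mem_image_of_mem (fun x => (U x : EReal)) hx)) h1
        have h3 : U x < r := EReal.coe_lt_coe_iff.1 h3
        have h4 : 0 < x * y := mul_pos hx hy
        show U x - x * y ≤ r
        linarith
  · refine ⟨sInf ((fun x => (U x : EReal)) '' Ioi 0), ?_, ?_, ?_⟩
    · have h : sInf ((fun x => (U x : EReal)) '' Ioi 0) ≤ (U 1 : EReal) :=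
        sInf_le ⟨1, by simp, rfl⟩
      exact ne_of_lt (lt_of_le_of_lt h (EReal.coe_lt_top _))
    · rw [tendsto_order]
      constructor
      · intro a ha
        filter_upwards [self_mem_nhdsWithin] with x hx
        exact lt_of_lt_of_le ha (sInf_le ⟨x, hx, rfl⟩)
      · intro a ha
        obtain ⟨_, ⟨x0, hx0, rfl⟩, h⟩ := sInf_lt_iff.1 ha
        filter_upwards [Ioo_mem_nhdsGT (show (0:ℝ) < x0 from hx0)] with x hx
        refine lt_of_le_of_lt ?_ h
        exact EReal.coe_le_coe_iff.2 (hU_mono.monotoneOn hx.1 hx0 hx.2.le)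
    · rw [tendsto_order]
      constructor
      · intro a ha
        obtain ⟨r, har, hr⟩ := EReal.lt_iff_exists_real_btwn.1 ha
        obtain ⟨s, hrs, hs⟩ := EReal.lt_iff_exists_real_btwn.1 hr
        have hrs : r < s := EReal.coe_lt_coe_iff.1 hrs
        filter_upwards [eventually_gt_atTop 0] with y hy
        have hx : 0 < (s - r) / y := div_pos (by linarith) hy
        have h1 : U ((s - r) / y) - (s - r) / y * y ≤ V y := (hV y hy).1 ⟨_, hx, rfl⟩
        rw [div_mul_cancel₀ _ hy.ne'] at h1
        have h2 : (s : EReal) < U ((s - r) / y) := lt_of_lt_of_le hs (sInf_le ⟨_, hx, rfl⟩)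
        have h2 := EReal.coe_lt_coe_iff.1 h2
        exact har.trans (EReal.coe_lt_coe_iff.2 (by linarith))
      · intro a ha
        obtain ⟨_, ⟨x0, hx0, rfl⟩, h⟩ := sInf_lt_iff.1 ha
        have hx0' : 0 < x0 := hx0
        filter_upwards [eventually_gt_atTop 0,
          eventually_ge_atTop ((U x0 - U (x0 / 2)) / (x0 - x0 / 2))] with y hy hys
        refine lt_of_le_of_lt (EReal.coe_le_coe_iff.2 ((hV y hy).2 ?_)) h
        rintro _ ⟨x, hx, rfl⟩
        have hx' : 0 < x := hx
        show U x - x * y ≤ U x0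
        rcases le_or_gt x x0 with hxx | hxx
        · have h3 := hU_mono.monotoneOn hx hx0 hxx
          have h4 : 0 < x * y := mul_pos hx hy
          linarith
        · have h3 := hU_conc.slope_anti_adjacent (half_pos hx0' : (0:ℝ) < x0 / 2) hx
            (half_lt_self hx0') hxx
          have h4 := (div_lt_iff₀ (sub_pos.2 hxx)).1 (h3.trans_le hys)
          nlinarith [mul_pos hx0' hy]
end
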